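/- arXiv:1812.09168 — 2 statements merged into one kernel-verified Lean document; each statement's English description precedes it below -/
import Mathlib

section
/- Let p ≥ 2, V > 0, and let (W_u)_{u ⊆ [1:p]} be real constants with W_∅ = 0. On a probability space, let (σ_m)_{m ≥ 1} be i.i.d. random permutations of [1:p], uniformly distributed on the set S_p of all p! permutations. For each nonempty proper subset u of [1:p], let (Ŵ_u(m))_{m ≥ 1} be i.i.d. integrable real random variables with E[Ŵ_u(m)] = W_u; set Ŵ_∅(m) = 0 and Ŵ_{[1:p]}(m) = W_{[1:p]}. Assume the family ((Ŵ_u(m))_{∅ ⊊ u ⊊ [1:p]})_{m ≥ 1} is i.i.d. across m, with all the Ŵ_u(m) mutually independent, and independent of (σ_m)_{m≥1}. For i ∈ [1:p] and σ ∈ S_p, let P_i(σ) = {σ(j) : j ∈ [1 : σ^{-1}(i) − 1]}. Then for every i ∈ [1:p], η̂_i^{(M)} := (1/(M·V)) ∑_{m=1}^M ( Ŵ_{P_i(σ_m)∪{i}}(m) − Ŵ_{P_i(σ_m)}(m) ) converges in probability, as M → ∞, to the Shapley effect η_i := (1/(p·V)) ∑_{u ⊆ [1:p]\{i}} binom(p−1,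 |u|)^{-1} (W_{u∪{i}} − W_u). -/
open MeasureTheory ProbabilityTheory Finset Filter
open scoped ENNReal

instance instMeasurableSpacePermFin {p : ℕ} : MeasurableSpace (Equiv.Perm (Fin p)) := ⊤

/-- The elements that precede `i` in the ordering `π 0, π 1, …` of `Fin p`. -/
def Equiv.Perm.predecessors {p : ℕ} (π : Equiv.Perm (Fin p)) (i : Fin p) : Finset (Fin p) :=
  Finset.univ.filter fun x => π.symm x < π.symm i

theorem Equiv.Perm.mem_predecessors {p : ℕ} (π : Equiv.Perm (Fin p)) (i x : Fin p) :
    x ∈ π.predecessors i ↔ π.symm x < π.symm i := by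
  simp [Equiv.Perm.predecessors]

theorem Equiv.Perm.card_predecessors {p : ℕ} (π : Equiv.Perm (Fin p)) (i : Fin p) :
    (π.predecessors i).card = (π.symm i : ℕ) := by
  have h : (π.predecessors i).map π.symm.toEmbedding = Finset.Iio (π.symm i) := by
    ext y
    simp [Equiv.Perm.mem_predecessors]
  rw [← Finset.card_map π.symm.toEmbedding, h, Fin.card_Iio]

theorem Equiv.Perm.predecessors_subset_erase {p : ℕ} (π : Equiv.Perm (Fin p)) (i : Fin p) :
    π.predecessors i ⊆ Finset.univ.erase i := by
  intro x hx
  rw [Equiv.Perm.mem_predecessors] at hx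
  have : x ≠ i := by
    rintro rfl
    exact lt_irrefl _ hx
  simpa using this

/-- The number of permutations of `Fin p` placing `i` at a given position is `(p - 1)!`. -/
theorem card_filter_symm_apply_eq {p : ℕ} (i k : Fin p) :
    (Finset.univ.filter fun π : Equiv.Perm (Fin p) => π.symm i = k).card
      = (p - 1).factorial := by
  have hconst : ∀ j : Fin p,
      (Finset.univ.filter fun π : Equiv.Perm (Fin p) => π.symm i = j).card
        = (Finset.univ.filter fun π : Equiv.Perm (Fin p) => π.symm i = k).card := by
    intro j
    refine Finset.card_equiv (Equiv.mulRight (Equiv.swap k j)) fun π => ?_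
    simp only [Finset.mem_filter, Finset.mem_univ, true_and, Equiv.coe_mulRight]
    have : (π * Equiv.swap k j).symm i = Equiv.swap k j (π.symm i) := rfl
    rw [this, Equiv.swap_apply_eq_iff, Equiv.swap_apply_left]
  have hsum := Finset.card_eq_sum_card_fiberwise (s := (Finset.univ : Finset (Equiv.Perm (Fin p))))
    (t := Finset.univ) (f := fun π => π.symm i) (fun _ _ => by simp)
  simp only [hconst, Finset.sum_const, Finset.card_univ, Fintype.card_perm, Fintype.card_fin,
    smul_eq_mul] at hsum
  have hp : 0 < p := i.pos
  rw [← Nat.mul_factorial_pred hp.ne'] at hsum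
  exact (Nat.eq_of_mul_eq_mul_left hp hsum).symm

/-- Permutations fixing `i` act transitively on the sets of a given size that avoid `i`. -/
theorem exists_perm_fixing_map_eq {α : Type*} [Fintype α] [DecidableEq α] {i : α}
    {u v : Finset α} (hu : i ∉ u) (hv : i ∉ v) (h : u.card = v.card) :
    ∃ τ : Equiv.Perm α, τ i = i ∧ ∀ x, τ x ∈ v ↔ x ∈ u := by
  let e : {x // x ∈ u} ≃ {x // x ∈ v} := Fintype.equivOfCardEq (by simpa using h)
  have he : ∀ x, e.extendSubtype x ∈ v ↔ x ∈ u := fun x =>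
    ⟨fun hx => by
      by_contra hxu
      exact e.extendSubtype_not_mem x hxu hx, fun hx => e.extendSubtype_mem x hx⟩
  have hi : e.extendSubtype i ∉ v := fun hx => hu ((he i).1 hx)
  refine ⟨e.extendSubtype.trans (Equiv.swap (e.extendSubtype i) i), by simp, fun x => ?_⟩
  rw [← he x, Equiv.trans_apply]
  rcases eq_or_ne (e.extendSubtype x) (e.extendSubtype i) with h1 | h1
  · simp [h1, hv, hi]
  · rcases eq_or_ne (e.extendSubtype x) i with h2 | h2
    · simp [h2, hv, hi]
    · rw [Equiv.swap_apply_of_ne_of_ne h1 h2]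

/-- The number of permutations for which `u` is the set of predecessors of `i` is
`(p - 1)! / (p - 1).choose #u`. -/
theorem card_filter_predecessors_eq_mul_choose {p : ℕ} {i : Fin p} {u : Finset (Fin p)}
    (hu : i ∉ u) :
    (p - 1).choose u.card
        * (Finset.univ.filter fun π : Equiv.Perm (Fin p) => π.predecessors i = u).card
      = (p - 1).factorial := by
  have hcard : u.card < p := by
    simpa using Finset.card_lt_univ_of_notMem hu
  have hconst : ∀ v ∈ Finset.powersetCard u.card (Finset.univ.erase i),
      (Finset.univ.filter fun π : Equiv.Perm (Fin p) => π.predecessors i = v).card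
        = (Finset.univ.filter fun π : Equiv.Perm (Fin p) => π.predecessors i = u).card := by
    intro v hv
    rw [Finset.mem_powersetCard] at hv
    have hiv : i ∉ v := fun h => by simpa using hv.1 h
    obtain ⟨τ, hτi, hτ⟩ := exists_perm_fixing_map_eq hiv hu hv.2
    refine Finset.card_equiv (Equiv.mulLeft τ) fun π => ?_
    simp only [Finset.mem_filter, Finset.mem_univ, true_and, Equiv.coe_mulLeft]
    have hmul : ∀ x, τ x ∈ (τ * π).predecessors i ↔ x ∈ π.predecessors i := by
      intro x
      have h1 : (τ * π).symm (τ x) = π.symm x := by simp [Equiv.Perm.mul_def]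
      have h2 : (τ * π).symm i = π.symm i := by
        conv_lhs => rw [← hτi]
        simp [Equiv.Perm.mul_def]
      rw [Equiv.Perm.mem_predecessors, Equiv.Perm.mem_predecessors, h1, h2]
    constructor
    · intro h
      ext y
      obtain ⟨x, rfl⟩ := τ.surjective y
      rw [hmul, hτ, h]
    · intro h
      ext x
      rw [← hmul, h, hτ]
  have hmaps : ∀ π ∈ Finset.univ.filter
      (fun π : Equiv.Perm (Fin p) => π.symm i = ⟨u.card, hcard⟩),
      π.predecessors i ∈ Finset.powersetCard u.card (Finset.univ.erase i) := by
    intro π hπ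
    rw [Finset.mem_powersetCard, Equiv.Perm.card_predecessors, (Finset.mem_filter.1 hπ).2]
    exact ⟨π.predecessors_subset_erase i, rfl⟩
  rw [← card_filter_symm_apply_eq i ⟨u.card, hcard⟩, Finset.card_eq_sum_card_fiberwise hmaps]
  have hfib : ∀ v ∈ Finset.powersetCard u.card (Finset.univ.erase i),
      ((Finset.univ.filter fun π : Equiv.Perm (Fin p) => π.symm i = ⟨u.card, hcard⟩).filter
        fun π => π.predecessors i = v).card
        = (Finset.univ.filter fun π : Equiv.Perm (Fin p) => π.predecessors i = u).card := by
    intro v hv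
    rw [← hconst v hv, Finset.filter_filter]
    congr 1
    refine Finset.filter_congr fun π _ => ⟨fun h => h.2, fun h => ⟨?_, h⟩⟩
    apply Fin.ext
    rw [← Equiv.Perm.card_predecessors, h, (Finset.mem_powersetCard.1 hv).2]
  rw [Finset.sum_congr rfl hfib]
  simp

/-- Averaging over permutations a function of the set of predecessors of `i` gives the Shapley
weights. -/
theorem sum_perm_predecessors {p : ℕ} (i : Fin p) (g : Finset (Fin p) → ℝ) :
    (p.factorial : ℝ)⁻¹ * ∑ π : Equiv.Perm (Fin p), g (π.predecessors i)
      = (p : ℝ)⁻¹ * ∑ u ∈ (Finset.univ.erase i).powerset,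
          (((p - 1).choose u.card : ℝ))⁻¹ * g u := by
  have hp : p ≠ 0 := i.pos.ne'
  have hfib := Finset.sum_fiberwise_of_maps_to' (s := Finset.univ)
    (t := (Finset.univ.erase i).powerset) (g := fun π : Equiv.Perm (Fin p) => π.predecessors i)
    (fun π _ => Finset.mem_powerset.2 (π.predecessors_subset_erase i)) g
  rw [← hfib, ← Nat.mul_factorial_pred hp, Nat.cast_mul, mul_inv, mul_assoc, Finset.mul_sum]
  congr 1
  refine Finset.sum_congr rfl fun u hu => ?_
  have hiu : i ∉ u := fun h => by simpa using Finset.mem_powerset.1 hu h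
  have hmul := card_filter_predecessors_eq_mul_choose hiu
  have hchoose : ((p - 1).choose u.card : ℝ) ≠ 0 := by
    intro h
    rw [Nat.cast_eq_zero] at h
    rw [h, zero_mul] at hmul
    exact (Nat.factorial_pos _).ne hmul
  have hfact : ((p - 1).factorial : ℝ) ≠ 0 := by exact_mod_cast Nat.factorial_ne_zero _
  have hcast := congrArg (Nat.cast : ℕ → ℝ) hmul
  push_cast at hcast
  rw [Finset.sum_const, nsmul_eq_mul]
  field_simp
  linear_combination g u * hcast

/-- Strong law of large numbers for products of two independent sequences of identically
distributed random variables. -/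
theorem strong_law_ae_mul {Ω ι : Type*} [MeasurableSpace Ω] {μ : Measure Ω}
    [IsProbabilityMeasure μ] {f : ι × ℕ → Ω → ℝ} (hf : iIndepFun f μ)
    (hmeas : ∀ j, AEMeasurable (f j) μ) {a b : ι} (hab : a ≠ b)
    (ha : ∀ m, IdentDistrib (f (a, m)) (f (a, 0)) μ μ)
    (hb : ∀ m, IdentDistrib (f (b, m)) (f (b, 0)) μ μ)
    (hinta : Integrable (f (a, 0)) μ) (hintb : Integrable (f (b, 0)) μ) :
    ∀ᵐ ω ∂μ, Tendsto (fun n : ℕ => (∑ m ∈ Finset.range n, f (a, m) ω * f (b, m) ω) / n) atTop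
      (nhds (μ[f (a, 0)] * μ[f (b, 0)])) := by
  have hpair : ∀ m, IndepFun (f (a, m)) (f (b, m)) μ := fun m =>
    hf.indepFun (by simpa using hab)
  rw [← (hpair 0).integral_mul_eq_mul_integral hinta.1 hintb.1]
  refine strong_law_ae_real (fun m => f (a, m) * f (b, m))
    ((hpair 0).integrable_mul hinta hintb) (fun m n hmn => ?_) fun m => ?_
  · exact hf.indepFun_mul_mul₀ hmeas _ _ _ _ (by simpa using hmn) (by simp [hmn])
      (by simp [hmn]) (by simpa using hmn)
  · exact ((ha m).prodMk (hb m) (hpair m) (hpair 0)).comp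
      (u := fun x : ℝ × ℝ => x.1 * x.2) (measurable_fst.mul measurable_snd)

/-- Consistency of the random-permutation W-aggregation procedure with unbiased,
mutually independent estimators of the conditional elements: the estimator
`η̂_i^{(M)} = (1/(M·V)) ∑_{m<M} (Ŵ_{P_i(σ_m)∪{i}}(m) − Ŵ_{P_i(σ_m)}(m))` converges in
probability to the Shapley effect
`η_i = (1/(p·V)) ∑_{u ⊆ [1:p]∖{i}} C(p−1,|u|)⁻¹ (W_{u∪{i}} − W_u)`. -/
theorem random_permutation_procedure_consistency {Ω : Type*} [MeasurableSpace Ω]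
    (μ : Measure Ω) [IsProbabilityMeasure μ]
    (p : ℕ) (hp : 2 ≤ p) (V : ℝ) (hV : 0 < V)
    (W : Finset (Fin p) → ℝ) (hW0 : W ∅ = 0)
    (σs : ℕ → Ω → Equiv.Perm (Fin p))
    (hσmeas : ∀ m, Measurable (σs m))
    (hσunif : ∀ m (π : Equiv.Perm (Fin p)),
      μ {ω | σs m ω = π} = ((p.factorial : ℝ≥0∞))⁻¹)
    (hatW : Finset (Fin p) → ℕ → Ω → ℝ)
    (hhat0 : ∀ m ω, hatW ∅ m ω = 0)
    (hhatfull : ∀ m ω, hatW Finset.univ m ω = W Finset.univ)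
    (hint : ∀ (u : Finset (Fin p)) (m : ℕ), Integrable (hatW u m) μ)
    (hmean : ∀ u : Finset (Fin p), u.Nonempty → u ≠ Finset.univ →
      ∀ m, ∫ ω, hatW u m ω ∂μ = W u)
    (hid : ∀ (u : Finset (Fin p)) (m : ℕ), IdentDistrib (hatW u m) (hatW u 0) μ μ)
    (hindep : iIndep (fun i : Option (Finset (Fin p)) × ℕ =>
      match i with
      | (none, m) => MeasurableSpace.comap (σs m) ⊤
      | (some u, m) => MeasurableSpace.comap (hatW u m) inferInstance) μ) :
    ∀ i : Fin p,
      TendstoInMeasure μ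
        (fun (M : ℕ) (ω : Ω) => (1 / ((M : ℝ) * V)) * ∑ m ∈ Finset.range M,
          (hatW (insert i
              (Finset.univ.filter fun x => (σs m ω).symm x < (σs m ω).symm i)) m ω
            - hatW (Finset.univ.filter fun x => (σs m ω).symm x < (σs m ω).symm i) m ω))
        atTop
        (fun _ => (1 / ((p : ℝ) * V)) * ∑ u ∈ (Finset.univ.erase i).powerset,
          (((p - 1).choose u.card : ℝ))⁻¹ * (W (insert i u) - W u)) := by
  intro i
  have hWmean : ∀ u : Finset (Fin p), ∫ ω, hatW u 0 ω ∂μ = W u := by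
    intro u
    rcases u.eq_empty_or_nonempty with rfl | hne
    · simp [hhat0, hW0]
    · by_cases hu : u = Finset.univ
      · subst hu
        simp [hhatfull]
      · exact hmean u hne hu 0
  have hσid : ∀ m, IdentDistrib (σs m) (σs 0) μ μ := by
    intro m
    refine ⟨(hσmeas m).aemeasurable, (hσmeas 0).aemeasurable, ?_⟩
    have : MeasurableSingletonClass (Equiv.Perm (Fin p)) := ⟨fun _ => trivial⟩
    refine Measure.ext_of_singleton fun π => ?_
    rw [Measure.map_apply (hσmeas m) (measurableSet_singleton π),
      Measure.map_apply (hσmeas 0) (measurableSet_singleton π)]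
    exact (hσunif m π).trans (hσunif 0 π).symm
  let ind : Equiv.Perm (Fin p) → ℕ → Ω → ℝ := fun π m ω => if σs m ω = π then 1 else 0
  have hcomp : ∀ π : Equiv.Perm (Fin p),
      Measurable (fun τ : Equiv.Perm (Fin p) => if τ = π then (1 : ℝ) else 0) :=
    fun π _ _ => trivial
  have hindmeas : ∀ π m, Measurable (ind π m) := fun π m => (hcomp π).comp (hσmeas m)
  have hindint : ∀ π m, Integrable (ind π m) μ := fun π m =>
    Integrable.of_bound (hindmeas π m).aestronglyMeasurable 1 <| Eventually.of_forall fun ω => by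
      by_cases h : σs m ω = π <;> simp [ind, h]
  have hindmean : ∀ π, ∫ ω, ind π 0 ω ∂μ = (p.factorial : ℝ)⁻¹ := by
    intro π
    have hset : MeasurableSet {ω | σs 0 ω = π} :=
      hσmeas 0 (show MeasurableSet ({π} : Set (Equiv.Perm (Fin p))) from trivial)
    have heq : ind π 0 = Set.indicator {ω | σs 0 ω = π} 1 := by
      ext ω
      simp [ind, Set.indicator_apply]
    rw [heq, integral_indicator_one hset, Measure.real, hσunif 0 π]
    simp
  have hterm : ∀ (π : Equiv.Perm (Fin p)) (u : Finset (Fin p)),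
      ∀ᵐ ω ∂μ, Tendsto (fun n : ℕ => (∑ m ∈ Finset.range n, ind π m ω * hatW u m ω) / n) atTop
        (nhds ((p.factorial : ℝ)⁻¹ * W u)) := by
    intro π u
    let f : Option (Finset (Fin p)) × ℕ → Ω → ℝ := fun j => j.1.elim (ind π j.2) (hatW · j.2)
    have hf : iIndepFun f μ := by
      rw [iIndepFun_iff_iIndep]
      refine iIndep_of_iIndep_of_le hindep ?_
      rintro ⟨_ | u, m⟩
      · rintro _ ⟨t, ht, rfl⟩
        exact ⟨_, hcomp π ht, rfl⟩
      · exact le_rfl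
    have hfmeas : ∀ j, AEMeasurable (f j) μ := by
      rintro ⟨_ | u, m⟩
      · exact (hindmeas π m).aemeasurable
      · exact (hint u m).aemeasurable
    have h := strong_law_ae_mul hf hfmeas (a := none) (b := some u) (by simp)
      (fun m => (hσid m).comp (hcomp π)) (hid u) (hindint π 0) (hint u 0)
    rw [← hindmean π, ← hWmean u]
    exact h
  have hdecomp : ∀ (n : ℕ) (ω : Ω), (1 / ((n : ℝ) * V)) * ∑ m ∈ Finset.range n,
      (hatW (insert i ((σs m ω).predecessors i)) m ω - hatW ((σs m ω).predecessors i) m ω)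
      = V⁻¹ * ∑ π : Equiv.Perm (Fin p),
        ((∑ m ∈ Finset.range n, ind π m ω * hatW (insert i (π.predecessors i)) m ω) / n
          - (∑ m ∈ Finset.range n, ind π m ω * hatW (π.predecessors i) m ω) / n) := by
    intro n ω
    simp only [← sub_div, ← Finset.sum_sub_distrib, ← mul_sub]
    rw [← Finset.sum_div, Finset.sum_comm]
    simp only [ind, ite_mul, one_mul, zero_mul, Finset.sum_ite_eq, Finset.mem_univ, if_true]
    rw [one_div, mul_inv]
    ring
  have hlimit : (1 / ((p : ℝ) * V)) * ∑ u ∈ (Finset.univ.erase i).powerset,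
      (((p - 1).choose u.card : ℝ))⁻¹ * (W (insert i u) - W u)
      = V⁻¹ * ∑ π : Equiv.Perm (Fin p),
        ((p.factorial : ℝ)⁻¹ * W (insert i (π.predecessors i))
          - (p.factorial : ℝ)⁻¹ * W (π.predecessors i)) := by
    simp only [← mul_sub]
    rw [← Finset.mul_sum, sum_perm_predecessors i fun u => W (insert i u) - W u, one_div, mul_inv]
    ring
  change TendstoInMeasure μ (fun (n : ℕ) (ω : Ω) => (1 / ((n : ℝ) * V)) * ∑ m ∈ Finset.range n,
      (hatW (insert i ((σs m ω).predecessors i)) m ω - hatW ((σs m ω).predecessors i) m ω))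
    atTop _
  simp only [hdecomp, hlimit]
  refine tendstoInMeasure_of_tendsto_ae (fun n => ?_) ?_
  · have hmul : ∀ π u m, AEStronglyMeasurable (fun ω => ind π m ω * hatW u m ω) μ :=
      fun π u m => (hindmeas π m).aestronglyMeasurable.mul (hint u m).1
    have hdiv : ∀ π u, AEStronglyMeasurable
        (fun ω => (∑ m ∈ Finset.range n, ind π m ω * hatW u m ω) / n) μ := fun π u => by
      simpa only [div_eq_mul_inv] using
        (Finset.aestronglyMeasurable_fun_sum _ fun m _ => hmul π u m).mul_const _
    exact (Finset.aestronglyMeasurable_fun_sum _ fun π _ =>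
      (hdiv π _).sub (hdiv π _)).const_mul _
  · filter_upwards [ae_all_iff.2 fun π => ae_all_iff.2 (hterm π)] with ω hω
    exact (tendsto_finsetSum _ fun π _ => (hω π _).sub (hω π _)).const_mul _
end

section
/- Let E_u and E_v be Polish spaces equipped with finite Borel measures μ_u and μ_v, respectively, and let f : E_u × E_v → [0, ∞) be bounded and measurable. Define g(y) = ∫_{E_u} f(x, y) dμ_u(x). Fix y ∈ E_v such that g(y) > 0 and such that, for μ_u-almost every x ∈ E_u, the function f(x, ·) is continuous at y. Let (y_n)_{n} be a sequence in E_v converging to y with g(y_n) > 0 for all n. Then g(y_n) → g(y), and the probability measures ν_n on E_u with density f(·, y_n)/g(y_n) with respect to μ_u converge weakly to the probability measure ν with density f(·, y)/g(y) with respect to μ_u: for every bounded continuous φ : E_u → ℝ, ∫ φ dν_n → ∫ φ dν. -/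
open MeasureTheory Filter

/-- Bounded convergence for sections: if `f` is bounded and `f (x, ·)` is continuous at `y` for
almost every `x`, then integrating the sections against a bounded weight is sequentially
continuous at `y`. -/
theorem tendsto_integral_mul_section {α β : Type*} [MeasurableSpace α]
    [MeasurableSpace β] [TopologicalSpace β] {μ : Measure α} [IsFiniteMeasure μ]
    {f : α × β → ℝ} (hfmeas : Measurable f) {M : ℝ} (hf : ∀ z, |f z| ≤ M) {y : β}
    (hcont : ∀ᵐ x ∂μ, ContinuousAt (fun y' => f (x, y')) y)
    {yseq : ℕ → β} (hyseq : Tendsto yseq atTop (nhds y))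
    {φ : α → ℝ} (hφ : Measurable φ) {C : ℝ} (hC : ∀ x, |φ x| ≤ C) :
    Tendsto (fun n => ∫ x, φ x * f (x, yseq n) ∂μ) atTop (nhds (∫ x, φ x * f (x, y) ∂μ)) := by
  refine tendsto_integral_of_dominated_convergence (fun _ => C * M) (fun n => ?_)
    (integrable_const _) (fun n => ae_of_all _ fun x => ?_) ?_
  · exact (hφ.mul (hfmeas.comp measurable_prodMk_right)).aestronglyMeasurable
  · rw [Real.norm_eq_abs, abs_mul]
    exact mul_le_mul (hC x) (hf _) (abs_nonneg _) ((abs_nonneg _).trans (hC x))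
  · filter_upwards [hcont] with x hx
    exact (hx.tendsto.comp hyseq).const_mul (φ x)

/-- Continuity of the conditional distributions: if `f ≥ 0` is a bounded measurable
function on `E_u × E_v`, `g(y) = ∫ f(x,y) dμ_u(x) > 0` at `y`, `f(x,·)` is continuous at
`y` for `μ_u`-a.e. `x`, and `y_n → y` with `g(y_n) > 0`, then `g(y_n) → g(y)` and the
probability measures with density `f(·,y_n)/g(y_n)` w.r.t. `μ_u` converge weakly to the
one with density `f(·,y)/g(y)`. -/
theorem conditional_distribution_weak_continuity {Eu Ev : Type*}
    [MetricSpace Eu] [CompleteSpace Eu] [TopologicalSpace.SeparableSpace Eu]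
    [MeasurableSpace Eu] [BorelSpace Eu]
    [MetricSpace Ev] [CompleteSpace Ev] [TopologicalSpace.SeparableSpace Ev]
    [MeasurableSpace Ev] [BorelSpace Ev]
    (μu : Measure Eu) [IsFiniteMeasure μu] (μv : Measure Ev) [IsFiniteMeasure μv]
    (f : Eu × Ev → ℝ) (hfmeas : Measurable f)
    (M : ℝ) (hf : ∀ z, 0 ≤ f z ∧ f z ≤ M)
    (y : Ev) (hgy : 0 < ∫ x, f (x, y) ∂μu)
    (hcont : ∀ᵐ x ∂μu, ContinuousAt (fun y' => f (x, y')) y)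
    (yseq : ℕ → Ev) (hyseq : Tendsto yseq atTop (nhds y))
    (hgyn : ∀ n, 0 < ∫ x, f (x, yseq n) ∂μu) :
    Tendsto (fun n => ∫ x, f (x, yseq n) ∂μu) atTop (nhds (∫ x, f (x, y) ∂μu)) ∧
    ∀ φ : Eu → ℝ, Continuous φ → (∃ Cφ, ∀ x, |φ x| ≤ Cφ) →
      Tendsto (fun n => ∫ x, φ x * (f (x, yseq n) / ∫ x', f (x', yseq n) ∂μu) ∂μu)
        atTop
        (nhds (∫ x, φ x * (f (x, y) / ∫ x', f (x', y) ∂μu) ∂μu)) := by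
  have hfabs : ∀ z, |f z| ≤ M := fun z => by
    rw [abs_of_nonneg (hf z).1]
    exact (hf z).2
  have hg : Tendsto (fun n => ∫ x, f (x, yseq n) ∂μu) atTop (nhds (∫ x, f (x, y) ∂μu)) := by
    simpa using tendsto_integral_mul_section hfmeas hfabs hcont hyseq
      (measurable_const (a := (1 : ℝ))) (C := 1) (by simp)
  refine ⟨hg, ?_⟩
  rintro φ hφ ⟨C, hC⟩
  simp_rw [← mul_div_assoc, integral_div]
  exact (tendsto_integral_mul_section hfmeas hfabs hcont hyseq hφ.measurable hC).div hg hgy.ne'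
end
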